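/- Let G be a simple graph with n vertices, minimum degree at least 4r, and Cheeger constant h(G) ≥ m, where r and m are positive integers. Let U_1, U_2 be disjoint sets of vertices with |U_1| ≥ m, |U_2| ≥ m and |U_1| + |U_2| ≥ n − r. Then there exist at least rm pairwise edge-disjoint paths in G, each of length at most 3, with one endpoint in U_1 and the other endpoint in U_2. -/

import Mathlib

open scoped BigOperators Classical

/-- The number of edges of `G` with exactly one end in `U`. -/
noncomputable def edgeBoundaryCard {n : ℕ} (G : SimpleGraph (Fin n)) (U : Finset (Fin n)) : ℕ :=
  (Finset.univ.filter fun p : Fin n × Fin n => G.Adj p.1 p.2 ∧ p.1 ∈ U ∧ p.2 ∉ U).card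

section ShortPaths

variable {n : ℕ} {G : SimpleGraph (Fin n)}

/-- The neighbours of `v` in `S`. -/
noncomputable def neighborsIn (G : SimpleGraph (Fin n)) (v : Fin n) (S : Finset (Fin n)) :
    Finset (Fin n) :=
  S.filter (G.Adj v)

lemma mem_neighborsIn {v u : Fin n} {S : Finset (Fin n)} :
    u ∈ neighborsIn G v S ↔ u ∈ S ∧ G.Adj v u := by
  simp [neighborsIn]

lemma card_neighborsIn_le (v : Fin n) (S : Finset (Fin n)) :
    (neighborsIn G v S).card ≤ S.card :=
  Finset.card_filter_le _ _

lemma ncard_neighborSet_le {A B X : Finset (Fin n)} (hcover : ∀ v, v ∈ A ∨ v ∈ B ∨ v ∈ X)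
    (v : Fin n) :
    (G.neighborSet v).ncard ≤
      (neighborsIn G v A).card + (neighborsIn G v B).card + (neighborsIn G v X).card := by
  have hsub : G.neighborSet v ⊆
      ((neighborsIn G v A ∪ neighborsIn G v B ∪ neighborsIn G v X : Finset (Fin n)) :
        Set (Fin n)) := by
    intro u hu
    have hu' : G.Adj v u := hu
    have := hcover u
    simp only [Finset.coe_union, Set.mem_union, Finset.mem_coe, mem_neighborsIn]
    tauto
  have h := Set.ncard_le_ncard hsub (Finset.finite_toSet _)
  rw [Set.ncard_coe_finset] at h
  have h₁ := Finset.card_union_le (neighborsIn G v A ∪ neighborsIn G v B) (neighborsIn G v X)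
  have h₂ := Finset.card_union_le (neighborsIn G v A) (neighborsIn G v B)
  omega

/-- The edges between `A` and `B`, as ordered pairs. -/
noncomputable def edgesBetween (G : SimpleGraph (Fin n)) (A B : Finset (Fin n)) :
    Finset (Fin n × Fin n) :=
  (A ×ˢ B).filter fun p => G.Adj p.1 p.2

lemma mem_edgesBetween {A B : Finset (Fin n)} {p : Fin n × Fin n} :
    p ∈ edgesBetween G A B ↔ (p.1 ∈ A ∧ p.2 ∈ B) ∧ G.Adj p.1 p.2 := by
  simp [edgesBetween]

lemma card_edgesBetween_comm (A B : Finset (Fin n)) :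
    (edgesBetween G A B).card = (edgesBetween G B A).card := by
  refine Finset.card_bij' (fun p _ => p.swap) (fun p _ => p.swap) ?_ ?_ ?_ ?_ <;>
    simp +contextual [mem_edgesBetween, G.adj_comm]

lemma card_edgesBetween_eq_sum (A B : Finset (Fin n)) :
    (edgesBetween G A B).card = ∑ a ∈ A, (neighborsIn G a B).card := by
  simp only [edgesBetween, neighborsIn, Finset.card_filter, Finset.sum_product]

lemma edgeBoundaryCard_le {A B X : Finset (Fin n)} (hcover : ∀ v, v ∈ A ∨ v ∈ B ∨ v ∈ X) :
    edgeBoundaryCard G A ≤ (edgesBetween G A B).card + A.card * X.card := by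
  rw [← Finset.card_product]
  refine le_trans (Finset.card_le_card ?_) (Finset.card_union_le _ _)
  intro p hp
  have := hcover p.2
  simp only [Finset.mem_filter, Finset.mem_univ, true_and] at hp
  simp only [Finset.mem_union, mem_edgesBetween, Finset.mem_product]
  tauto

/-- Deleting a set `X` of at most `r` vertices from a graph of minimum degree at least `4r` and
Cheeger constant at least `m` leaves many edges across every cut with large sides. -/
lemma mul_le_card_edgesBetween {r m : ℕ} (hm : 0 < m)
    (hdeg : ∀ v, 4 * r ≤ (G.neighborSet v).ncard)
    (hCheeger : ∀ U : Finset (Fin n), U.Nonempty → (U.card : ℝ) ≤ (n : ℝ) / 2 →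
      (m : ℝ) * (U.card : ℝ) ≤ (edgeBoundaryCard G U : ℝ))
    {A B X : Finset (Fin n)} (hcover : ∀ v, v ∈ A ∨ v ∈ B ∨ v ∈ X) (hAB : Disjoint A B)
    (hA : m ≤ A.card) (hB : m ≤ B.card) (hX : X.card ≤ r) :
    r * m ≤ (edgesBetween G A B).card + r * X.card := by
  wlog hle : A.card ≤ B.card generalizing A B
  · rw [card_edgesBetween_comm]
    exact this (fun v => by have := hcover v; tauto) hAB.symm hB hA (by omega)
  rcases le_total r A.card with hr | hr
  · have hn : A.card + B.card ≤ n := by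
      rw [← Finset.card_union_of_disjoint hAB]
      simpa using Finset.card_le_univ (A ∪ B)
    have hhalf : (A.card : ℝ) ≤ (n : ℝ) / 2 := by
      have : ((A.card + A.card : ℕ) : ℝ) ≤ n := by exact_mod_cast (by omega)
      push_cast at this
      linarith
    have h₁ : m * A.card ≤ edgeBoundaryCard G A := by
      exact_mod_cast hCheeger A (Finset.card_pos.1 (by omega)) hhalf
    have h₂ := edgeBoundaryCard_le (G := G) hcover
    rcases le_total m X.card with hk | hk
    · exact le_add_left (Nat.mul_le_mul_left r hk)
    · nlinarith [Nat.mul_le_mul hr hk]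
  · have hsum : A.card * r ≤ (edgesBetween G A B).card := by
      rw [card_edgesBetween_eq_sum, ← smul_eq_mul]
      refine Finset.card_nsmul_le_sum _ _ _ fun a _ => ?_
      have h₁ := (hdeg a).trans (ncard_neighborSet_le hcover a)
      have h₂ := card_neighborsIn_le (G := G) a A
      have h₃ := card_neighborsIn_le (G := G) a X
      omega
    nlinarith

lemma exists_injOn_mapsTo {α β : Type*} [Nonempty β] {S : Finset α} {T : Finset β}
    (h : S.card ≤ T.card) : ∃ f : α → β, (∀ a ∈ S, f a ∈ T) ∧ Set.InjOn f S := by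
  obtain ⟨e⟩ := Function.Embedding.nonempty_of_card_le (α := S) (β := T) (by simpa using h)
  refine ⟨fun a => if ha : a ∈ S then (e ⟨a, ha⟩ : β) else Classical.arbitrary β,
    fun a ha => by simp [ha], fun a ha b hb hab => ?_⟩
  have ha' : a ∈ S := ha
  have hb' : b ∈ S := hb
  simpa [ha', hb', Subtype.ext_iff] using hab

lemma exists_injOn_neighborsIn {r : ℕ} {U U' W S : Finset (Fin n)} {v : Fin n}
    (hdeg : 4 * r ≤ (G.neighborSet v).ncard) (hcover : ∀ v, v ∈ U ∨ v ∈ U' ∨ v ∈ W)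
    (hW : W.card ≤ r) (hU' : (neighborsIn G v U').card < r) (hS : S ⊆ U' ∪ W) :
    ∃ f : Fin n → Fin n, (∀ u ∈ neighborsIn G v S, f u ∈ neighborsIn G v U) ∧
      Set.InjOn f (neighborsIn G v S) := by
  have : Nonempty (Fin n) := ⟨v⟩
  refine exists_injOn_mapsTo ?_
  have hsub : neighborsIn G v S ⊆ neighborsIn G v U' ∪ neighborsIn G v W := by
    intro u hu
    have := @hS u
    simp only [Finset.mem_union, mem_neighborsIn] at hu this ⊢
    tauto
  have h₁ := (Finset.card_le_card hsub).trans (Finset.card_union_le _ _)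
  have h₂ := hdeg.trans (ncard_neighborSet_le hcover v)
  have h₃ := card_neighborsIn_le (G := G) v W
  omega

/-- The edge set `E` contains a path of length at most `3` from `U₁` to `U₂`. -/
def ContainsShortPath (G : SimpleGraph (Fin n)) (U₁ U₂ : Finset (Fin n))
    (E : Set (Sym2 (Fin n))) : Prop :=
  ∃ w : Σ u : Fin n, Σ v : Fin n, G.Walk u v,
    (w.2.2.IsPath ∧ w.2.2.length ≤ 3 ∧ w.1 ∈ U₁ ∧ w.2.1 ∈ U₂) ∧ ∀ e ∈ w.2.2.edges, e ∈ E

lemma exists_edgeDisjoint_of_containsShortPath {ι : Type*} [Fintype ι] {N : ℕ}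
    (hN : N ≤ Fintype.card ι) {U₁ U₂ : Finset (Fin n)} {E : ι → Set (Sym2 (Fin n))}
    (hE : ∀ i, ContainsShortPath G U₁ U₂ (E i)) (hdisj : ∀ i j e, e ∈ E i → e ∈ E j → i = j) :
    ∃ w : Fin N → Σ u : Fin n, Σ v : Fin n, G.Walk u v,
      (∀ i, (w i).2.2.IsPath ∧ (w i).2.2.length ≤ 3 ∧ (w i).1 ∈ U₁ ∧ (w i).2.1 ∈ U₂) ∧
      (∀ i i', i ≠ i' → ∀ e, e ∈ (w i).2.2.edges → e ∉ (w i').2.2.edges) := by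
  obtain ⟨φ⟩ := Function.Embedding.nonempty_of_card_le (α := Fin N) (β := ι) (by simpa using hN)
  choose w hw hwE using hE
  exact ⟨fun i => w (φ i), fun i => hw _, fun i j hij e hi hj =>
    hij (φ.injective (hdisj _ _ e (hwE _ e hi) (hwE _ e hj)))⟩

/-- A cut edge `ab`, extended at those ends that lie outside `U₁`, respectively `U₂`. -/
def extendedEdge (U₁ U₂ : Finset (Fin n)) (a b a' b' : Fin n) : Set (Sym2 (Fin n)) :=
  {e | e = s(a, b) ∨ (a ∉ U₁ ∧ e = s(a', a)) ∨ (b ∉ U₂ ∧ e = s(b, b'))}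

lemma containsShortPath_extendedEdge {U₁ U₂ : Finset (Fin n)} (hU : Disjoint U₁ U₂)
    {a b a' b' : Fin n} (hab : G.Adj a b) (ha₂ : a ∉ U₂) (hb₁ : b ∉ U₁)
    (ha' : a ∉ U₁ → a' ∈ U₁ ∧ G.Adj a a') (hb' : b ∉ U₂ → b' ∈ U₂ ∧ G.Adj b b') :
    ContainsShortPath G U₁ U₂ (extendedEdge U₁ U₂ a b a' b') := by
  have hU' := Finset.disjoint_left.1 hU
  have hne := hab.ne
  by_cases ha : a ∈ U₁ <;> by_cases hb : b ∈ U₂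
  · exact ⟨⟨a, b, hab.toWalk⟩, by simp [ha, hb, hne], by simp [extendedEdge]⟩
  · obtain ⟨hb₂, hadj⟩ := hb' hb
    refine ⟨⟨a, b', .cons hab hadj.toWalk⟩, ?_, ?_⟩
    · have := hadj.ne
      have : a ≠ b' := by grind
      simp_all
    · simp_all [extendedEdge]
  · obtain ⟨ha₁, hadj⟩ := ha' ha
    refine ⟨⟨a', b, .cons hadj.symm hab.toWalk⟩, ?_, ?_⟩
    · have := hadj.ne'
      have : a' ≠ b := by grind
      simp_all
    · simp_all [extendedEdge]
  · obtain ⟨ha₁, hadj⟩ := ha' ha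
    obtain ⟨hb₂, hadj'⟩ := hb' hb
    refine ⟨⟨a', b', .cons hadj.symm (.cons hab hadj'.toWalk)⟩, ?_, ?_⟩
    · have := hadj.ne'
      have := hadj'.ne
      have : a' ≠ b := by grind
      have : a' ≠ b' := by grind
      have : a ≠ b' := by grind
      simp_all
    · simp_all [extendedEdge]

lemma eq_of_mem_extendedEdge {U₁ U₂ A B : Finset (Fin n)} (hAB : Disjoint A B) (hA : U₁ ⊆ A)
    (hB : U₂ ⊆ B) {a b a' b' x y x' y' : Fin n} (ha : a ∈ A) (ha' : a' ∈ A) (hb : b ∈ B)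
    (hb' : b' ∈ B) (hx : a ∉ U₁ → x ∈ U₁) (hx' : a' ∉ U₁ → x' ∈ U₁)
    (hy : b ∉ U₂ → y ∈ U₂) (hy' : b' ∉ U₂ → y' ∈ U₂)
    (hxx' : a ∉ U₁ → a = a' → x = x' → b = b') (hyy' : b ∉ U₂ → b = b' → y = y' → a = a')
    {e : Sym2 (Fin n)} (he : e ∈ extendedEdge U₁ U₂ a b x y)
    (he' : e ∈ extendedEdge U₁ U₂ a' b' x' y') : a = a' ∧ b = b' := by
  have hne : ∀ u ∈ A, ∀ v ∈ B, u ≠ v := fun u hu v hv huv =>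
    Finset.disjoint_left.1 hAB hu (huv ▸ hv)
  rcases he with rfl | ⟨h, rfl⟩ | ⟨h, rfl⟩ <;> rcases he' with h' | ⟨h', he'⟩ | ⟨h', he'⟩
  · rcases Sym2.eq_iff.1 h' with h | h
    · exact h
    · exact absurd h.1 (hne _ ha _ hb')
  · rcases Sym2.eq_iff.1 he' with h | h
    · exact absurd h.2.symm (hne _ ha' _ hb)
    · exact absurd h.2.symm (hne _ (hA (hx' h')) _ hb)
  · rcases Sym2.eq_iff.1 he' with h | h
    · exact absurd h.1 (hne _ ha _ hb')
    · exact absurd h.1 (hne _ ha _ (hB (hy' h')))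
  · rcases Sym2.eq_iff.1 h' with h | h
    · exact absurd h.2 (hne _ ha _ hb')
    · exact absurd h.1 (hne _ (hA (hx ‹_›)) _ hb')
  · rcases Sym2.eq_iff.1 he' with h₁ | h₁
    · exact ⟨h₁.2, hxx' h h₁.2 h₁.1⟩
    · exact absurd (h₁.2 ▸ hx' h') h
  · rcases Sym2.eq_iff.1 he' with h₁ | h₁
    · exact absurd h₁.1 (hne _ (hA (hx h)) _ hb')
    · exact absurd h₁.2 (hne _ ha _ hb')
  · rcases Sym2.eq_iff.1 h' with h₁ | h₁
    · exact absurd h₁.1.symm (hne _ ha' _ hb)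
    · exact absurd h₁.2.symm (hne _ ha' _ (hB (hy h)))
  · rcases Sym2.eq_iff.1 he' with h₁ | h₁
    · exact absurd h₁.1.symm (hne _ (hA (hx' h')) _ hb)
    · exact absurd h₁.1.symm (hne _ ha' _ hb)
  · rcases Sym2.eq_iff.1 he' with h₁ | h₁
    · exact ⟨hyy' h h₁.1 h₁.2, h₁.1⟩
    · exact absurd (h₁.1 ▸ hy' h') h

lemma containsShortPath_pair {U₁ U₂ : Finset (Fin n)} (hU : Disjoint U₁ U₂) {x p q : Fin n}
    (hp : p ∈ U₁) (hq : q ∈ U₂) (hxp : G.Adj x p) (hxq : G.Adj x q) :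
    ContainsShortPath G U₁ U₂ {s(p, x), s(x, q)} := by
  have : p ≠ q := by
    have := Finset.disjoint_left.1 hU
    grind
  refine ⟨⟨p, q, .cons hxp.symm hxq.toWalk⟩, ?_, ?_⟩
  · have := hxp.ne'
    have := hxq.ne
    simp_all
  · simp

lemma eq_of_mem_pair {α : Type*} {x p q x' p' q' : α} (hxp : x ≠ p') (hxq : x ≠ q')
    (hpq : p ≠ q') (hqp : p' ≠ q) {e : Sym2 α} (he : e ∈ ({s(p, x), s(x, q)} : Set (Sym2 α)))
    (he' : e ∈ ({s(p', x'), s(x', q')} : Set (Sym2 α))) : x = x' ∧ (p = p' ∨ q = q') := by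
  simp only [Set.mem_insert_iff, Set.mem_singleton_iff] at he he'
  rcases he with rfl | rfl <;> simp only [Sym2.eq_iff] at he' <;> grind

end ShortPaths

/-- Let `G` be a graph on `n` vertices with minimum degree at least `4r` and
Cheeger constant at least `m`.  If `U₁, U₂` are disjoint vertex sets with `|U₁|, |U₂| ≥ m` and
`|U₁| + |U₂| ≥ n − r`, then there are at least `rm` pairwise edge-disjoint paths of length at
most `3` from `U₁` to `U₂`. -/
theorem exists_many_short_paths (n r m : ℕ) (hr : 0 < r) (hm : 0 < m)
    (G : SimpleGraph (Fin n))
    (hdeg : ∀ v, 4 * r ≤ (G.neighborSet v).ncard)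
    (hCheeger : ∀ U : Finset (Fin n), U.Nonempty → (U.card : ℝ) ≤ (n : ℝ) / 2 →
      (m : ℝ) * (U.card : ℝ) ≤ (edgeBoundaryCard G U : ℝ))
    (U1 U2 : Finset (Fin n)) (hdisj : Disjoint U1 U2)
    (h1 : m ≤ U1.card) (h2 : m ≤ U2.card)
    (h12 : (n : ℝ) - (r : ℝ) ≤ (U1.card : ℝ) + (U2.card : ℝ)) :
    ∃ w : Fin (r * m) → Σ u : Fin n, Σ v : Fin n, G.Walk u v,
      (∀ i, (w i).2.2.IsPath ∧ (w i).2.2.length ≤ 3 ∧ (w i).1 ∈ U1 ∧ (w i).2.1 ∈ U2) ∧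
      (∀ i i', i ≠ i' → ∀ e, e ∈ (w i).2.2.edges → e ∉ (w i').2.2.edges) := by
  have hU := Finset.disjoint_left.1 hdisj
  set W : Finset (Fin n) := (U1 ∪ U2)ᶜ with hWdef
  have memW : ∀ v, v ∈ W ↔ v ∉ U1 ∧ v ∉ U2 := by simp [hWdef]
  have hW : W.card ≤ r := by
    have h12' : n ≤ U1.card + U2.card + r := by
      have : (n : ℝ) ≤ ((U1.card + U2.card + r : ℕ) : ℝ) := by push_cast; linarith
      exact_mod_cast this
    rw [hWdef, Finset.card_compl, Fintype.card_fin, Finset.card_union_of_disjoint hdisj]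
    omega
  set X := W.filter fun v => r ≤ (neighborsIn G v U1).card ∧ r ≤ (neighborsIn G v U2).card
    with hXdef
  set A := U1 ∪ W.filter fun v => (neighborsIn G v U2).card < r with hAdef
  set B := (A ∪ X)ᶜ with hBdef
  have memX : ∀ v, v ∈ X ↔ v ∈ W ∧ r ≤ (neighborsIn G v U1).card ∧
      r ≤ (neighborsIn G v U2).card := by simp [hXdef]
  have memA : ∀ v, v ∈ A ↔ v ∈ U1 ∨ v ∈ W ∧ (neighborsIn G v U2).card < r := by simp [hAdef]
  have memB : ∀ v, v ∈ B ↔ v ∉ A ∧ v ∉ X := by simp [hBdef]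
  have hcover : ∀ v, v ∈ A ∨ v ∈ B ∨ v ∈ X := fun v => by rw [memB]; tauto
  have hU1A : U1 ⊆ A := Finset.subset_union_left
  have hU2B : U2 ⊆ B := fun v hv => by
    have := @hU v
    rw [memB, memA, memX, memW]
    tauto
  have hAW : A ⊆ U1 ∪ W := fun v => by
    rw [memA, Finset.mem_union]
    tauto
  have hBW : B ⊆ U2 ∪ W := fun v => by
    rw [memB, memA, Finset.mem_union, memW]
    tauto
  have hXW : X ⊆ W := Finset.filter_subset _ _
  have hAB : Disjoint A B := Finset.disjoint_left.2 fun v hv hv' => ((memB v).1 hv').1 hv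
  have hcount := mul_le_card_edgesBetween hm hdeg hCheeger hcover hAB
    (h1.trans (Finset.card_le_card hU1A)) (h2.trans (Finset.card_le_card hU2B))
    ((Finset.card_le_card hXW).trans hW)
  have hf : ∀ a, ∃ f : Fin n → Fin n, a ∈ A → a ∉ U1 →
      (∀ u ∈ neighborsIn G a B, f u ∈ neighborsIn G a U1) ∧
        Set.InjOn f (neighborsIn G a B) := by
    intro a
    by_cases ha : a ∈ A ∧ a ∉ U1
    · obtain ⟨f, hf⟩ := exists_injOn_neighborsIn (S := B) (U := U1) (hdeg a)
        (fun v => by rw [memW]; tauto) hW (by have := (memA a).1 ha.1; tauto) hBW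
      exact ⟨f, fun _ _ => hf⟩
    · exact ⟨id, fun h h' => absurd ⟨h, h'⟩ ha⟩
  have hg : ∀ b, ∃ g : Fin n → Fin n, b ∈ B → b ∉ U2 →
      (∀ u ∈ neighborsIn G b A, g u ∈ neighborsIn G b U2) ∧
        Set.InjOn g (neighborsIn G b A) := by
    intro b
    by_cases hb : b ∈ B ∧ b ∉ U2
    · have hlt : (neighborsIn G b U1).card < r := by
        have := (memB b).1 hb.1
        rw [memA, memX, memW] at this
        have := hb.2
        by_contra!
        have := lt_or_ge (neighborsIn G b U2).card r
        tauto
      obtain ⟨g, hg⟩ := exists_injOn_neighborsIn (S := A) (U := U2) (hdeg b)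
        (fun v => by rw [memW]; tauto) hW hlt hAW
      exact ⟨g, fun _ _ => hg⟩
    · exact ⟨id, fun h h' => absurd ⟨h, h'⟩ hb⟩
  choose f hf using hf
  choose g hg using hg
  have hpq : ∀ x : X, ∃ p q : Fin r → Fin n, (∀ i, p i ∈ neighborsIn G x U1) ∧
      (∀ i, q i ∈ neighborsIn G x U2) ∧ p.Injective ∧ q.Injective := by
    intro x
    have : Nonempty (Fin n) := ⟨x⟩
    have hx := (memX x).1 x.2
    obtain ⟨p, hp, hp'⟩ := exists_injOn_mapsTo (S := (Finset.univ : Finset (Fin r)))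
      (T := neighborsIn G x U1) (by simpa using hx.2.1)
    obtain ⟨q, hq, hq'⟩ := exists_injOn_mapsTo (S := (Finset.univ : Finset (Fin r)))
      (T := neighborsIn G x U2) (by simpa using hx.2.2)
    exact ⟨p, q, by simpa using hp, by simpa using hq, by simpa using hp', by simpa using hq'⟩
  choose p q hp hq hp' hq' using hpq
  simp only [mem_neighborsIn] at hf hg hp hq
  refine exists_edgeDisjoint_of_containsShortPath (ι := edgesBetween G A B ⊕ X × Fin r)
    (E := Sum.elim
      (fun c => extendedEdge U1 U2 c.1.1 c.1.2 (f c.1.1 c.1.2) (g c.1.2 c.1.1))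
      (fun y => {s(p y.1 y.2, (y.1 : Fin n)), s((y.1 : Fin n), q y.1 y.2)})) ?_ ?_ ?_
  · simpa [mul_comm] using hcount
  · rintro (⟨⟨a, b⟩, hc⟩ | ⟨x, i⟩)
    · obtain ⟨⟨ha, hb⟩, hab⟩ := mem_edgesBetween.1 hc
      refine containsShortPath_extendedEdge hdisj hab
        (fun h => Finset.disjoint_left.1 hAB ha (hU2B h))
        (fun h => Finset.disjoint_left.1 hAB (hU1A h) hb)
        (fun h => (hf a ha h).1 b ⟨hb, hab⟩) (fun h => (hg b hb h).1 a ⟨ha, hab.symm⟩)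
    · exact containsShortPath_pair hdisj (hp x i).1 (hq x i).1 (hp x i).2 (hq x i).2
  · have hXA : ∀ v ∈ X, v ∉ A := fun v hv => by
      have := (memX v).1 hv
      rw [memA]
      have := (memW v).1 this.1
      rintro (h | h)
      · exact this.1 h
      · omega
    have hXB : ∀ v ∈ X, v ∉ B := fun v hv hv' => ((memB v).1 hv').2 hv
    have hpA : ∀ x i, p x i ∈ A := fun x i => hU1A (hp x i).1
    have hqB : ∀ x i, q x i ∈ B := fun x i => hU2B (hq x i).1
    have hfU : ∀ c ∈ edgesBetween G A B, c.1 ∉ U1 → f c.1 c.2 ∈ U1 := by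
      intro c hc h
      obtain ⟨⟨ha, hb⟩, hab⟩ := mem_edgesBetween.1 hc
      exact ((hf _ ha h).1 _ ⟨hb, hab⟩).1
    have hgU : ∀ c ∈ edgesBetween G A B, c.2 ∉ U2 → g c.2 c.1 ∈ U2 := by
      intro c hc h
      obtain ⟨⟨ha, hb⟩, hab⟩ := mem_edgesBetween.1 hc
      exact ((hg _ hb h).1 _ ⟨ha, hab.symm⟩).1
    have hmem : ∀ c ∈ edgesBetween G A B, ∀ e ∈ extendedEdge U1 U2 c.1 c.2 (f c.1 c.2) (g c.2 c.1),
        ∀ v ∈ X, v ∉ e := by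
      rintro c hc e he v hv
      obtain ⟨⟨ha, hb⟩, -⟩ := mem_edgesBetween.1 hc
      have := hXA v hv
      have := hXB v hv
      rcases he with rfl | ⟨h, rfl⟩ | ⟨h, rfl⟩
      · rw [Sym2.mem_iff]
        grind
      · have := hU1A (hfU c hc h)
        rw [Sym2.mem_iff]
        grind
      · have := hU2B (hgU c hc h)
        rw [Sym2.mem_iff]
        grind
    have hcut : ∀ c ∈ edgesBetween G A B, ∀ c' ∈ edgesBetween G A B, ∀ e,
        e ∈ extendedEdge U1 U2 c.1 c.2 (f c.1 c.2) (g c.2 c.1) →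
        e ∈ extendedEdge U1 U2 c'.1 c'.2 (f c'.1 c'.2) (g c'.2 c'.1) → c = c' := by
      rintro c hc c' hc' e he he'
      have hfc := hfU c hc
      have hfc' := hfU c' hc'
      have hgc := hgU c hc
      have hgc' := hgU c' hc'
      obtain ⟨a, b⟩ := c
      obtain ⟨a', b'⟩ := c'
      obtain ⟨⟨ha, hb⟩, hab⟩ := mem_edgesBetween.1 hc
      obtain ⟨⟨ha', hb'⟩, hab'⟩ := mem_edgesBetween.1 hc'
      dsimp only at *
      have hfinj : a ∉ U1 → a = a' → f a b = f a' b' → b = b' := by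
        rintro h rfl h'
        exact (hf a ha h).2 (mem_neighborsIn.2 ⟨hb, hab⟩) (mem_neighborsIn.2 ⟨hb', hab'⟩) h'
      have hginj : b ∉ U2 → b = b' → g b a = g b' a' → a = a' := by
        rintro h rfl h'
        exact (hg b hb h).2 (mem_neighborsIn.2 ⟨ha, hab.symm⟩)
          (mem_neighborsIn.2 ⟨ha', hab'.symm⟩) h'
      exact Prod.ext_iff.2 (eq_of_mem_extendedEdge hAB hU1A hU2B ha ha' hb hb' hfc hfc' hgc hgc'
        hfinj hginj he he')
    rintro (⟨c, hc⟩ | ⟨x, i⟩) (⟨c', hc'⟩ | ⟨x', i'⟩) e he he'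
    · exact congrArg Sum.inl (Subtype.ext (hcut c hc c' hc' e he he'))
    · refine absurd ?_ (hmem c hc e he x' x'.2)
      rcases he' with rfl | rfl <;> simp
    · refine absurd ?_ (hmem c' hc' e he' x x.2)
      rcases he with rfl | rfl <;> simp
    · simp only [Sum.elim_inr] at he he'
      obtain ⟨hx, hi⟩ := eq_of_mem_pair (ne_of_mem_of_not_mem (hpA x' i') (hXA x x.2)).symm
        (ne_of_mem_of_not_mem (hqB x' i') (hXB x x.2)).symm
        (Finset.disjoint_iff_ne.1 hAB _ (hpA x i) _ (hqB x' i'))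
        (Finset.disjoint_iff_ne.1 hAB _ (hpA x' i') _ (hqB x i)) he he'
      obtain rfl : x = x' := Subtype.ext hx
      obtain rfl : i = i' := hi.elim (fun h => hp' x h) (fun h => hq' x h)
      rfl
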